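/- The series ∑_{n=0}^∞ ((1/2)_n)^3/((1)_n^3) · (9-4√5)^n · (20n+5-√5) equals 2√(10+5√5)/π. -/

import Mathlib

open Real

noncomputable def poch (a : ℝ) (n : ℕ) : ℝ := (ascPochhammer ℝ n).eval a

lemma poch_zero (a : ℝ) : poch a 0 = 1 := by simp [poch]

lemma poch_succ (a : ℝ) (n : ℕ) : poch a (n+1) = poch a n * (a + n) := by
  simp [poch, ascPochhammer_succ_right]

lemma poch_shift (a : ℝ) (n : ℕ) : a * poch (a+1) n = poch a n * (a + n) := by
  induction n with
  | zero => simp [poch_zero]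
  | succ k ih =>
    rw [poch_succ, poch_succ, ← mul_assoc, ih]; push_cast; ring

lemma poch_shift' (a : ℝ) (ha : a ≠ 0) (n : ℕ) : poch (a+1) n = poch a n * (a + n) / a := by
  rw [← poch_shift]; field_simp

lemma poch_add (a : ℝ) (m n : ℕ) : poch a (m+n) = poch a m * poch (a+m) n := by
  induction n with
  | zero => simp [poch_zero]
  | succ k ih =>
    rw [← add_assoc, poch_succ, poch_succ, ih]; push_cast; ring

lemma poch_pos (a : ℝ) (ha : 0 < a) (n : ℕ) : 0 < poch a n := by
  induction n with
  | zero => simp [poch_zero]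
  | succ k ih => rw [poch_succ]; positivity

lemma poch_neg_nat (N n : ℕ) (h : N < n) : poch (-(N:ℝ)) n = 0 := by
  induction n with
  | zero => omega
  | succ k ih =>
    rw [poch_succ]
    rcases Nat.lt_or_ge N k with h1 | h1
    · rw [ih h1]; simp
    · have : N = k := by omega
      subst this; simp

lemma poch_one (n : ℕ) : poch 1 n = (n.factorial : ℝ) := by
  induction n with
  | zero => simp [poch_zero]
  | succ k ih => rw [poch_succ, ih, Nat.factorial_succ]; push_cast; ring

lemma poch_neg_shift (N : ℝ) (hN : N + 1 ≠ 0) (n : ℕ) :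
    poch (-N) n = poch (-N-1) n * (N + 1 - n) / (N+1) := by
  have := poch_shift (-N-1) n
  rw [sub_add_cancel] at this
  field_simp
  linear_combination -this

/-- Saalschütz summand -/
noncomputable def fS (m n : ℕ) : ℝ :=
  poch (-(m:ℝ)) n * poch (1/2+m) n * poch (1/2) n / (poch 1 n)^3 * (poch 1 m)^2 / (poch (1/2) m)^2

noncomputable def hS (m n : ℕ) : ℝ :=
  -4 * (4*m+3) * n^3 / ((m+1) * (2*m+1)^3) *
  (poch (-(m:ℝ)-1) n * poch (1/2+m) n * poch (1/2) n / (poch 1 n)^3 * (poch 1 m)^2 / (poch (1/2) m)^2)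

lemma fS_step (m n : ℕ) : fS (m+1) n - fS m n = hS m (n+1) - hS m n := by
  have e1 : poch (-((m+1:ℕ):ℝ)) n = poch (-(m:ℝ)-1) n := by congr 1; push_cast; ring
  have e2 : poch (1/2+((m+1:ℕ):ℝ)) n = poch (1/2+m) n * (1/2 + m + n) / (1/2+m) := by
    rw [← poch_shift' _ (by positivity)]; congr 1; push_cast; ring
  have p1 := (poch_pos (1/2+m) (by positivity) n)
  have p2 := (poch_pos (1/2) (by positivity) n)
  have p3 := (poch_pos 1 (by positivity) n)
  have p4 := (poch_pos 1 (by positivity) m)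
  have p5 := (poch_pos (1/2) (by positivity) m)
  unfold fS hS
  rw [e1, e2, poch_neg_shift (m:ℝ) (by positivity), poch_succ _ n, poch_succ _ n,
    poch_succ _ n, poch_succ _ n, poch_succ _ m, poch_succ _ m]
  generalize poch (-(m:ℝ)-1) n = A at *
  generalize poch (1/2+(m:ℝ)) n = B at *
  generalize poch (1/2) n = C at *
  generalize poch 1 n = D at *
  generalize poch 1 m = E at *
  generalize poch (1/2) m = F at *
  push_cast
  have : (1/2 + (m:ℝ)) = (2*m+1)/2 := by ring
  rw [this]
  field_simp
  ring

lemma fS_sum (m : ℕ) : ∑ n ∈ Finset.range (m+1), fS m n = 1 := by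
  induction m with
  | zero => simp [fS, poch_zero]
  | succ m ih =>
    have h1 : fS m (m+1) = 0 := by simp [fS, poch_neg_nat m (m+1) (by omega)]
    have h2 : ∑ n ∈ Finset.range (m+1+1), (fS (m+1) n - fS m n) = 0 := by
      simp_rw [fS_step]
      rw [Finset.sum_range_sub]
      have : poch (-(m:ℝ)-1) (m+1+1) = 0 := by
        have := poch_neg_nat (m+1) (m+1+1) (by omega)
        rw [← this]; congr 1; push_cast; ring
      simp [hS, this]
    rw [Finset.sum_sub_distrib, Finset.sum_range_succ (fun n => fS m n), h1, ih] at h2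
    linarith

noncomputable def cc (n : ℕ) : ℝ := poch (1/2) n * poch (1/2) (2*n) / (16^n * (poch 1 n)^3)

noncomputable def BB (N n : ℕ) : ℝ := poch (1+(N:ℝ)) n ^2 / (poch (3/2+(N:ℝ)) n * poch (1/2+(N:ℝ)) (2*n))

noncomputable def RR (N n : ℕ) : ℝ :=
  (9+24*N+21*N^2+6*N^3 + n*(96+222*N+166*N^2+40*N^3) + n^2*(297+450*N+168*N^2)+n^3*(338+248*N)+120*n^4)
    / (2 * ((3+2*N+2*n)*(1+2*N+4*n)*(3+2*N+4*n)))

noncomputable def gg (N n : ℕ) : ℝ := cc n * (poch (-(N:ℝ)) n * BB N n * RR N n)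

noncomputable def hh (N n : ℕ) : ℝ :=
  -8 * n^3 / ((N+1) * (1+2*N+4*n)) * (cc n * poch (-(N:ℝ)-1) n * BB N n)

lemma poch_two (a : ℝ) (n : ℕ) : poch a (2*(n+1)) = poch a (2*n) * (a + 2*n) * (a+2*n+1) := by
  rw [show 2*(n+1) = 2*n+1+1 by ring, poch_succ, poch_succ]; push_cast; ring

lemma cc_succ (n : ℕ) : cc (n+1) = cc n * ((2*n+1) * (4*n+1)*(4*n+3) / (128 * (n+1)^3)) := by
  have p3 := (poch_pos 1 (by positivity) n)
  unfold cc
  rw [poch_two, poch_succ, poch_succ]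
  field_simp
  ring

lemma BB_succ (N n : ℕ) : BB N (n+1) = BB N n *
    (8 * (1+N+n)^2 / ((3+2*N+2*n) * (1+2*N+4*n) * (3+2*N+4*n))) := by
  have p1 := (poch_pos (3/2+N) (by positivity) n)
  have p2 := (poch_pos (1/2+N) (by positivity) (2*n))
  unfold BB
  rw [poch_two, poch_succ, poch_succ]
  generalize poch (3/2+(N:ℝ)) n = B at *
  generalize poch (1/2+(N:ℝ)) (2*n) = C at *
  rw [show (3/2 + (N:ℝ) + n) = (3+2*N+2*n)/2 by ring, show (1/2 + (N:ℝ) + 2*n) = (1+2*N+4*n)/2 by ring,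
    show ((1+2*N+4*n)/2 + 1 : ℝ) = (3+2*N+4*n)/2 by ring]
  field_simp
  ring

lemma BB_N (N n : ℕ) : BB (N+1) n = BB N n *
    ((1+N+n)^2 * (3+2*N) * (1+2*N) / ((1+N)^2 * (3+2*N+2*n) * (1+2*N+4*n))) := by
  have p1 := (poch_pos (3/2+N) (by positivity) n)
  have p2 := (poch_pos (1/2+N) (by positivity) (2*n))
  have e (a : ℝ) : a + ((N+1:ℕ):ℝ) = a + N + 1 := by push_cast; ring
  unfold BB
  rw [e, e, e, poch_shift' _ (by positivity), poch_shift' _ (by positivity), poch_shift' _ (by positivity)]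
  generalize poch (3/2+(N:ℝ)) n = B at *
  generalize poch (1/2+(N:ℝ)) (2*n) = C at *
  push_cast
  rw [show (3/2 + (N:ℝ) + n) = (3+2*N+2*n)/2 by ring, show (1/2 + (N:ℝ) + 2*n) = (1+2*N+4*n)/2 by ring,
    show (3/2+N:ℝ) = (3+2*N)/2 by ring, show (1/2+N:ℝ) = (1+2*N)/2 by ring]
  field_simp

lemma gg_step (N n : ℕ) : Wallis.W (N+1) * gg (N+1) n - Wallis.W N * gg N n =
    Wallis.W N * (hh N (n+1) - hh N n) := by
  have e1 : poch (-((N+1:ℕ):ℝ)) n = poch (-(N:ℝ)-1) n := by congr 1; push_cast; ring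
  unfold gg hh
  rw [e1, poch_neg_shift (N:ℝ) (by positivity), poch_succ _ n, BB_succ, BB_N, cc_succ, Wallis.W_succ]
  unfold RR
  generalize poch (-(N:ℝ)-1) n = A at *
  generalize Wallis.W N = B at *
  generalize BB N n = C at *
  generalize cc n = D at *
  push_cast
  rw [show (3+2*((N:ℝ)+1)+2*n) = 5+2*N+2*n by ring, show (1+2*((N:ℝ)+1)+4*n) = 3+2*N+4*n by ring,
    show (3+2*((N:ℝ)+1)+4*n) = 5+2*N+4*n by ring, show (1+2*(N:ℝ)+4*(n+1)) = 5+2*N+4*n by ring,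
    show (2*(N:ℝ)+1) = 1+2*N by ring, show (2*(N:ℝ)+3) = 3+2*N by ring, show (2*(N:ℝ)+2) = 2*(1+N) by ring,
    show ((N:ℝ)+1) = 1+N by ring]
  field_simp
  ring

lemma gg_sum (N : ℕ) : Wallis.W N * ∑ n ∈ Finset.range (N+1), gg N n = 1/2 := by
  induction N with
  | zero =>
    simp [gg, cc, BB, RR, poch_zero, Wallis.W]; norm_num
  | succ m ih =>
    have h1 : gg m (m+1) = 0 := by simp [gg, poch_neg_nat m (m+1) (by omega)]
    have h2 : ∑ n ∈ Finset.range (m+1+1), (Wallis.W (m+1) * gg (m+1) n - Wallis.W m * gg m n) = 0 := by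
      simp_rw [gg_step]
      rw [← Finset.mul_sum, Finset.sum_range_sub]
      have : poch (-(m:ℝ)-1) (m+1+1) = 0 := by
        have := poch_neg_nat (m+1) (m+1+1) (by omega)
        rw [← this]; congr 1; push_cast; ring
      simp [hh, this]
    rw [Finset.sum_sub_distrib, ← Finset.mul_sum, ← Finset.mul_sum,
      Finset.sum_range_succ (fun n => gg m n), h1, add_zero, ih] at h2
    linarith

lemma gg_tsum (N : ℕ) : ∑' n, gg N n = 1 / (2 * Wallis.W N) := by
  rw [tsum_eq_sum (s := Finset.range (N+1))]
  · have := gg_sum N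
    have := Wallis.W_pos N
    field_simp
    linarith
  · intro n hn
    have : N < n := by simpa using hn
    simp [gg, poch_neg_nat N n this]

lemma cc_nonneg (n : ℕ) : 0 ≤ cc n := by
  have p1 := (poch_pos (1/2) (by positivity) n)
  have p2 := (poch_pos (1/2) (by positivity) (2*n))
  have p3 := (poch_pos 1 (by positivity) n)
  unfold cc; positivity

lemma cc_le (n : ℕ) : cc n ≤ (1/4)^n := by
  induction n with
  | zero => simp [cc, poch_zero]
  | succ n ih =>
    rw [cc_succ, pow_succ]
    refine mul_le_mul ih ?_ (by positivity) (pow_nonneg (by norm_num) _)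
    rw [div_le_iff₀ (by positivity)]
    have : (0:ℝ) ≤ n := by positivity
    nlinarith [mul_nonneg this this]

lemma PB_le (N n : ℕ) : |poch (-(N:ℝ)) n * BB N n| ≤ (4/3)^n := by
  induction n with
  | zero => simp [BB, poch_zero]
  | succ n ih =>
    rw [BB_succ, poch_succ, mul_mul_mul_comm, abs_mul, pow_succ]
    refine mul_le_mul ih ?_ (by positivity) (pow_nonneg (by norm_num) _)
    have hN : (0:ℝ) ≤ N := by positivity
    have hn : (0:ℝ) ≤ n := by positivity
    have h1 : |-(N:ℝ) + n| ≤ (3+2*N+2*n)/2 := by rw [abs_le]; constructor <;> linarith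
    rw [abs_mul, abs_of_nonneg (a := 8 * _ / _) (by positivity)]
    calc _ ≤ (3+2*(N:ℝ)+2*n)/2 * (8 * (1+N+n)^2 / ((3+2*N+2*n) * (1+2*N+4*n) * (3+2*N+4*n))) :=
          mul_le_mul_of_nonneg_right h1 (by positivity)
      _ = 4 * (1+N+n)^2 / ((1+2*N+4*n) * (3+2*N+4*n)) := by field_simp; ring
      _ ≤ 4/3 := by
        rw [div_le_div_iff₀ (by positivity) (by positivity)]
        nlinarith [mul_nonneg hN hn, mul_nonneg hN hN, mul_nonneg hn hn]

lemma RR_nonneg (N n : ℕ) : 0 ≤ RR N n := by unfold RR; positivity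

lemma RR_le (N n : ℕ) : RR N n ≤ 20 * (n+1) := by
  unfold RR
  rw [div_le_iff₀ (by positivity), ← sub_nonneg]
  ring_nf
  positivity

lemma gg_le (N n : ℕ) : ‖gg N n‖ ≤ 20 * ((n+1) * (1/3)^n) := by
  unfold gg
  rw [Real.norm_eq_abs, abs_mul, abs_mul, abs_of_nonneg (cc_nonneg n), abs_of_nonneg (RR_nonneg N n)]
  calc _ ≤ (1/4)^n * ((4/3)^n * (20 * ((n:ℝ)+1))) := by
        have := RR_nonneg N n
        refine mul_le_mul (cc_le n) ?_ (by positivity) (by positivity)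
        exact mul_le_mul (PB_le N n) (RR_le N n) this (by positivity)
    _ = _ := by
      rw [← mul_assoc, ← mul_pow]; norm_num; ring

lemma bound_summable : Summable (fun n : ℕ => 20 * (((n:ℝ)+1) * (1/3)^n)) := by
  apply Summable.mul_left
  have h1 := summable_pow_mul_geometric_of_norm_lt_one 1 (r := (1/3:ℝ)) (by norm_num)
  have h2 := summable_geometric_of_lt_one (r := (1/3:ℝ)) (by norm_num) (by norm_num)
  refine (h1.add h2).congr ?_
  intro n; ring

open Filter Topology

lemma tlin (a b c d : ℝ) (hd : d ≠ 0) : Tendsto (fun N : ℕ => (a + c * (N:ℝ)) / (b + d * N)) atTop (𝓝 (c/d)) :=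
  tendsto_add_mul_div_add_mul_atTop_nhds a b c hd

lemma PB_lim (n : ℕ) : Tendsto (fun N : ℕ => poch (-(N:ℝ)) n * BB N n) atTop (𝓝 ((-1)^n)) := by
  induction n with
  | zero => simp [BB, poch_zero]
  | succ n ih =>
    have h := (((tlin n (3+2*n) (-1) 2 (by norm_num)).mul (tlin (1+n) (1+4*n) 1 2 (by norm_num))).mul
      (tlin (1+n) (3+4*n) 1 2 (by norm_num))).const_mul 8
    have := ih.mul h
    convert this using 2
    · rename_i N
      rw [BB_succ, poch_succ, mul_mul_mul_comm]
      congr 1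
      have e1 : (3 + 2 * (n:ℝ) + 2 * N) = 3+2*N+2*n := by ring
      have e2 : (1 + 4 * (n:ℝ) + 2 * N) = 1+2*N+4*n := by ring
      have e3 : (3 + 4 * (n:ℝ) + 2 * N) = 3+2*N+4*n := by ring
      rw [e1, e2, e3]
      field_simp
      ring
    · rw [pow_succ]; norm_num

lemma RR_lim (n : ℕ) : Tendsto (fun N : ℕ => RR N n) atTop (𝓝 ((20*n+3)/8)) := by
  have x1 := tlin 0 (3+2*n) 1 2 (by norm_num)
  have x2 := tlin 0 (1+4*n) 1 2 (by norm_num)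
  have x3 := tlin 0 (3+4*n) 1 2 (by norm_num)
  have y1 := tlin 1 (3+2*n) 0 2 (by norm_num)
  have y2 := tlin 1 (1+4*n) 0 2 (by norm_num)
  have y3 := tlin 1 (3+4*n) 0 2 (by norm_num)
  have h := (((((x1.mul x2).mul x3).const_mul (6+40*(n:ℝ))).add
    (((x1.mul x2).mul y3).const_mul (21+166*(n:ℝ)+168*n^2))).add
    ((((x1.mul y2).mul y3).const_mul (24+222*(n:ℝ)+450*n^2+248*n^3)).add
    (((y1.mul y2).mul y3).const_mul (9+96*(n:ℝ)+297*n^2+338*n^3+120*n^4)))).const_mul (1/2)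
  convert h using 2
  · rename_i N
    unfold RR
    have e1 : (3 + 2 * (n:ℝ) + 2 * N) = 3+2*N+2*n := by ring
    have e2 : (1 + 4 * (n:ℝ) + 2 * N) = 1+2*N+4*n := by ring
    have e3 : (3 + 4 * (n:ℝ) + 2 * N) = 3+2*N+4*n := by ring
    rw [e1, e2, e3]
    field_simp
    ring
  · ring

lemma guillera : ∑' n : ℕ, cc n * ((-1)^n * ((20*n+3)/8)) = 1 / π := by
  have h1 : Tendsto (fun N => ∑' n, gg N n) atTop (𝓝 (∑' n : ℕ, cc n * ((-1)^n * ((20*n+3)/8)))) :=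
    tendsto_tsum_of_dominated_convergence bound_summable
      (fun n => ((PB_lim n).mul (RR_lim n)).const_mul (cc n))
      (Eventually.of_forall fun N n => gg_le N n)
  have h2 : Tendsto (fun N => ∑' n, gg N n) atTop (𝓝 (1/π)) := by
    simp_rw [gg_tsum]
    have := (Wallis.tendsto_W_nhds_pi_div_two.const_mul 2)
    rw [mul_div_cancel₀ π (by norm_num : (2:ℝ) ≠ 0)] at this
    exact tendsto_const_nhds.div this pi_ne_zero
  exact tendsto_nhds_unique h1 h2

lemma HasSum.congr_fun_any {ι : Type*} {f g : ι → ℝ} {a : ℝ} (h : HasSum f a) (e : ∀ k, g k = f k) :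
    HasSum g a := by
  have : g = f := funext e
  rw [this]; exact h

lemma HasSum.congr_fun' {f g : ℕ → ℝ} {a : ℝ} (h : HasSum f a) (e : ∀ k, g k = f k) : HasSum g a := by
  have : g = f := funext e
  rw [this]; exact h

lemma HasSum.congr_val' {f : ℕ → ℝ} {a b : ℝ} (h : HasSum f a) (e : b = a) : HasSum f b := by
  rw [e]; exact h

lemma binom_hasSum (a x : ℝ) (hx : |x| < 1) :
    HasSum (fun k : ℕ => poch a k / k.factorial * x^k) (1 / (1-x)^a) := by
  have h := (one_div_one_sub_rpow_hasFPowerSeriesOnBall_zero a).hasSum (y := x)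
    (by rw [Metric.mem_eball, edist_zero_right, ← ofReal_norm, Real.norm_eq_abs]; simpa using hx)
  rw [zero_add] at h
  refine h.congr_fun' ?_
  intro k
  rw [FormalMultilinearSeries.ofScalars_apply_eq, ← Ring.multichoose_eq]
  have := Ring.factorial_nsmul_multichoose_eq_ascPochhammer a k
  rw [Polynomial.ascPochhammer_smeval_eq_eval] at this
  unfold poch
  rw [← this, nsmul_eq_mul, smul_eq_mul]
  field_simp

lemma poch_succ_left (a : ℝ) (k : ℕ) : poch a (k+1) = a * poch (a+1) k := by
  rw [poch_succ, poch_shift]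

lemma binom_hasSum' (a x : ℝ) (hx : |x| < 1) :
    HasSum (fun k : ℕ => poch a k / k.factorial * x^k * k) (a * x * (1 / (1-x)^(a+1))) := by
  have h := (binom_hasSum (a+1) x hx).mul_left (a*x)
  rw [← hasSum_nat_add_iff' 1]
  simp only [Finset.range_one, Finset.sum_singleton, Nat.cast_zero, mul_zero, sub_zero]
  refine h.congr_fun' ?_
  intro k
  rw [poch_succ_left, Nat.factorial_succ]
  push_cast
  field_simp
  ring

lemma poch_neg_fact (n k : ℕ) :
    poch (-((n+k:ℕ):ℝ)) n * k.factorial = (-1)^n * (n+k).factorial := by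
  induction n with
  | zero => simp [poch_zero]
  | succ n ih =>
    rw [poch_succ_left, show n + 1 + k = (n+k)+1 by ring, Nat.factorial_succ,
      show -(((n+k)+1:ℕ):ℝ) + 1 = -((n+k:ℕ):ℝ) by push_cast; ring, mul_assoc, ih]
    push_cast; ring

/-- coefficients of the double series -/
noncomputable def AA (n k : ℕ) : ℝ :=
  poch (1/2) n * poch (1/2) (2*n) / (poch 1 n)^3 * (poch (1/2+2*n) k / k.factorial)

lemma AA_eq (n k : ℕ) : (-1)^n * AA n k = fS (n+k) n * (poch (1/2) (n+k) / poch 1 (n+k))^3 := by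
  have h1 : poch (1/2) (n+k) * poch (1/2+((n+k:ℕ):ℝ)) n = poch (1/2) (2*n) * poch (1/2+2*n) k := by
    rw [← poch_add, show n + k + n = 2*n+k by ring, poch_add]; push_cast; rfl
  have h2 := poch_neg_fact n k
  have p1 := (poch_pos (1/2) (by positivity) (n+k))
  have p3 := (poch_pos 1 (by positivity) n)
  unfold AA fS
  rw [← poch_one (n+k)] at h2
  have p4 := (poch_pos 1 (by positivity) (n+k))
  have h3 : (-1:ℝ)^n = poch (-((n+k:ℕ):ℝ)) n * k.factorial / poch 1 (n+k) := by
    rw [h2]; field_simp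
  rw [h3]
  generalize poch (-((n+k:ℕ):ℝ)) n = X at *
  have h4 : poch (1/2+2*n) k * poch (1/2) (2*n) = poch (1/2) (n+k) * poch (1/2+((n+k:ℕ):ℝ)) n := by
    rw [h1]; ring
  calc _ = X * poch (1/2) n / (poch 1 (n+k) * (poch 1 n)^3) * (poch (1/2+2*n) k * poch (1/2) (2*n)) := by
        field_simp
    _ = _ := by rw [h4]; field_simp

lemma anti_sum (m : ℕ) : ∑ p ∈ Finset.HasAntidiagonal.antidiagonal m, (-1)^p.1 * AA p.1 p.2 =
    (poch (1/2) m / poch 1 m)^3 := by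
  have : ∀ p ∈ Finset.HasAntidiagonal.antidiagonal m, (-1)^p.1 * AA p.1 p.2 =
      fS m p.1 * (poch (1/2) m / poch 1 m)^3 := by
    intro p hp
    rw [Finset.HasAntidiagonal.mem_antidiagonal] at hp
    rw [AA_eq, hp]
  rw [Finset.sum_congr rfl this, ← Finset.sum_mul,
    Finset.Nat.sum_antidiagonal_eq_sum_range_succ (fun i j => fS m i), fS_sum, one_mul]

lemma AA_nonneg (n k : ℕ) : 0 ≤ AA n k := by
  have p1 := (poch_pos (1/2) (by positivity) n)
  have p2 := (poch_pos (1/2) (by positivity) (2*n))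
  have p3 := (poch_pos 1 (by positivity) n)
  have p4 := (poch_pos (1/2+2*n) (by positivity) k)
  unfold AA; positivity

lemma inner_hasSum_AA (n : ℕ) (x s : ℝ) (hs : s^2 = 5) (hs2 : 2 < s) (hs3 : s < 3) (hx : x = 9 - 4*s) :
    HasSum (fun k : ℕ => AA n k * x^(n+k) * (20*((n+k:ℕ):ℝ)+5-s))
      (1/(1-x)^(1/2:ℝ) * (s*4) * (cc n * ((20*n+3)/8))) := by
  have hs4 : s < 9/4 := by nlinarith
  have hx0 : 0 < x := by linarith
  have hx1 : x < 1 := by linarith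
  have hax : |x| < 1 := by rw [abs_of_pos hx0]; exact hx1
  have h1 := binom_hasSum (1/2+2*n) x hax
  have h2 := binom_hasSum' (1/2+2*n) x hax
  have h := ((h1.mul_left (20*(n:ℝ)+5-s)).add (h2.mul_left 20)).mul_left
    (poch (1/2) n * poch (1/2) (2*n) / (poch 1 n)^3 * x^n)
  refine HasSum.congr_val' (h.congr_fun' (fun k => ?_)) ?_
  · unfold AA
    rw [pow_add]; push_cast; ring
  · have hy : 0 < 1 - x := by linarith
    have e1 : (1-x)^(1/2+2*(n:ℝ)) = (1-x)^(1/2:ℝ) * ((1-x)^2)^n := by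
      rw [rpow_add hy, ← pow_mul, ← rpow_natCast]; push_cast; rfl
    have e2 : (1-x)^(1/2+2*(n:ℝ)+1) = (1-x)^(1/2:ℝ) * ((1-x)^2)^n * (1-x) := by
      rw [rpow_add hy, e1, rpow_one]
    have e3 : (1-x)^2 = 16 * x := by rw [hx]; nlinarith
    have e4 : x / (1-x) = (s-2)/4 := by
      rw [div_eq_div_iff (by positivity) (by norm_num), hx]; nlinarith
    have hr : 0 < (1-x)^(1/2:ℝ) := by positivity
    have p3 := (poch_pos 1 (by positivity) n)
    rw [e1, e2, e3]
    have e5 : 20*(n:ℝ)+5-s + 20*((1/2+2*(n:ℝ)) * (x/(1-x))) = s/2*(20*n+3) := by rw [e4]; ring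
    unfold cc
    generalize (1-x)^(1/2:ℝ) = r at *
    calc _ = poch (1/2) n * poch (1/2) (2*n) / (16^n * (poch 1 n)^3) * (1/r) * (s/2*(20*n+3)) := by ring
      _ = _ := by rw [← e5, mul_pow]; field_simp

lemma outer_summable : Summable (fun n : ℕ => cc n * ((20*(n:ℝ)+3)/8)) := by
  refine Summable.of_nonneg_of_le (fun n => ?_) (fun n => ?_) bound_summable
  · have := cc_nonneg n; positivity
  · calc cc n * ((20*(n:ℝ)+3)/8) ≤ (1/4)^n * (20*((n:ℝ)+1)) := by
          refine mul_le_mul (cc_le n) ?_ (by positivity) (by positivity)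
          have : (0:ℝ) ≤ n := by positivity
          linarith
      _ ≤ (1/3)^n * (20*((n:ℝ)+1)) := by gcongr; norm_num
      _ = _ := by ring

lemma main_hasSum (x s : ℝ) (hs : s^2 = 5) (hs2 : 2 < s) (hs3 : s < 3) (hx : x = 9 - 4*s) :
    HasSum (fun m : ℕ => (poch (1/2) m / poch 1 m)^3 * x^m * (20*(m:ℝ)+5-s))
      (1/(1-x)^(1/2:ℝ) * (s*4) * (1/π)) := by
  have hs4 : s < 9/4 := by nlinarith
  have hx0 : 0 < x := by linarith
  have hin := fun n => inner_hasSum_AA n x s hs hs2 hs3 hx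
  have hnn : ∀ n k : ℕ, 0 ≤ AA n k * x^(n+k) * (20*((n+k:ℕ):ℝ)+5-s) := by
    intro n k
    have := AA_nonneg n k
    have : 0 ≤ 20*((n+k:ℕ):ℝ)+5-s := by
      have : (0:ℝ) ≤ ((n+k:ℕ):ℝ) := by positivity
      linarith
    positivity
  have hsumabs : Summable (fun p : ℕ × ℕ => AA p.1 p.2 * x^(p.1+p.2) * (20*((p.1+p.2:ℕ):ℝ)+5-s)) := by
    rw [summable_prod_of_nonneg (fun p => hnn p.1 p.2)]
    refine ⟨fun n => (hin n).summable, ?_⟩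
    simp_rw [fun n => (hin n).tsum_eq]
    exact outer_summable.mul_left _
  have hsum : Summable (fun p : ℕ × ℕ => (-1)^p.1 * (AA p.1 p.2 * x^(p.1+p.2) * (20*((p.1+p.2:ℕ):ℝ)+5-s))) := by
    refine Summable.of_norm (hsumabs.congr fun p => ?_)
    rw [norm_mul, norm_pow, norm_neg, norm_one, one_pow, one_mul, Real.norm_of_nonneg (hnn _ _)]
  have hfib := hsum.hasSum.prod_fiberwise (fun n => (hin n).mul_left ((-1)^n))
  have hval : (∑' p : ℕ × ℕ, (-1)^p.1 * (AA p.1 p.2 * x^(p.1+p.2) * (20*((p.1+p.2:ℕ):ℝ)+5-s)))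
      = 1/(1-x)^(1/2:ℝ) * (s*4) * (1/π) := by
    rw [← hfib.tsum_eq, ← guillera, ← tsum_mul_left]
    congr 1; funext n; ring
  have h1 := hsum.hasSum
  rw [hval, ← Finset.HasAntidiagonal.sigmaAntidiagonalEquivProd.hasSum_iff] at h1
  refine h1.sigma (fun m => ?_)
  rw [← anti_sum m, Finset.sum_mul, Finset.sum_mul, ← Finset.sum_coe_sort]
  refine (hasSum_fintype _).congr_fun_any (fun q => ?_)
  have : q.1.1 + q.1.2 = m := Finset.HasAntidiagonal.mem_antidiagonal.1 q.2
  simp only [Function.comp, Finset.HasAntidiagonal.sigmaAntidiagonalEquivProd_apply, this]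
  ring

theorem stmt_18 :
    ∑' n : ℕ, (poch (1/2) n * poch (1/2) n * poch (1/2) n) / (poch 1 n)^3 * (20*(n:ℝ)+5 - Real.sqrt 5) * (9 - 4 * Real.sqrt 5)^n = 2 * Real.sqrt (10 + 5 * Real.sqrt 5) / π := by
  have hs : (Real.sqrt 5)^2 = 5 := Real.sq_sqrt (by norm_num)
  have hs2 : 2 < Real.sqrt 5 := by rw [Real.lt_sqrt (by norm_num)]; norm_num
  have hs3 : Real.sqrt 5 < 3 := by rw [Real.sqrt_lt' (by norm_num)]; norm_num
  have h := main_hasSum _ _ hs hs2 hs3 rfl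
  generalize Real.sqrt 5 = s at *
  have e : 1/(1-(9-4*s))^(1/2:ℝ) * (s*4) * (1/π) = 2 * Real.sqrt (10+5*s) / π := by
    have hv : Real.sqrt (10+5*s) = s * 2 / Real.sqrt (1-(9-4*s)) := by
      rw [Real.sqrt_eq_iff_mul_self_eq (by linarith) (by have := Real.sqrt_nonneg (1-(9-4*s)); positivity)]
      rw [div_mul_div_comm, Real.mul_self_sqrt (by linarith), eq_div_iff (by linarith)]
      nlinarith
    rw [hv, Real.sqrt_eq_rpow]
    field_simp
    ring
  rw [← e, ← h.tsum_eq]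
  congr 1; funext n
  rw [div_pow]; ring
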